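/- Assume that all functions in N^{1,p}(X) are quasicontinuous and that p > 1. Then cap_p is an outer capacity for sets in the interior of E: for every A ⊂ int E, cap_p(A,E) = inf { cap_p(G,E) : G open, A ⊂ G ⊂ E }. -/

import Mathlib

open MeasureTheory Metric Set Filter
open scoped ENNReal NNReal Topology

noncomputable section

variable {X : Type*} [MetricSpace X] [MeasurableSpace X] [BorelSpace X]

/-- A nonconstant, compact, rectifiable curve in `X`, parameterized by arc length on
`[0, len]`. The arc-length parameterization is expressed by requiring that the length
(total variation) of the curve on each subinterval `[s, t]` equals `t - s`. -/
structure Curve (X : Type*) [MetricSpace X] where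
  len : ℝ
  len_pos : 0 < len
  toFun : ℝ → X
  continuousOn : ContinuousOn toFun (Set.Icc 0 len)
  arclength : ∀ s t : ℝ, s ∈ Set.Icc 0 len → t ∈ Set.Icc 0 len → s ≤ t →
    eVariationOn toFun (Set.Icc s t) = ENNReal.ofReal (t - s)
  nonconstant : ∃ s ∈ Set.Icc 0 len, ∃ t ∈ Set.Icc 0 len, toFun s ≠ toFun t

/-- The curve integral `∫_γ g ds` of a nonnegative function along an arc-length
parameterized curve. -/
def Curve.integral (γ : Curve X) (g : X → ℝ≥0∞) : ℝ≥0∞ :=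
  ∫⁻ t in Set.Icc (0 : ℝ) γ.len, g (γ.toFun t)

/-- `|a - b|` with the convention that it is `∞` whenever both `a` and `b` are infinite. -/
def ugDiff (a b : EReal) : ℝ≥0∞ :=
  if a.abs = ⊤ ∨ b.abs = ⊤ then ⊤ else (a - b).abs

/-- The upper gradient inequality for `f` and `g` along the curve `γ`. -/
def UGOn (f : X → EReal) (g : X → ℝ≥0∞) (γ : Curve X) : Prop :=
  ugDiff (f (γ.toFun 0)) (f (γ.toFun γ.len)) ≤ γ.integral g

/-- A curve family has zero `p`-modulus. -/
def ZeroModulus (p : ℝ) (μ : Measure X) (Γ : Set (Curve X)) : Prop :=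
  ∃ ρ : X → ℝ≥0∞, Measurable ρ ∧ (∫⁻ x, ρ x ^ p ∂μ) < ⊤ ∧ ∀ γ ∈ Γ, γ.integral ρ = ⊤

/-- `g` is an upper gradient of `f`. -/
def IsUpperGradient (f : X → EReal) (g : X → ℝ≥0∞) : Prop :=
  Measurable g ∧ ∀ γ : Curve X, UGOn f g γ

/-- `g` is a `p`-weak upper gradient of `f`: the upper gradient inequality holds for
`p`-almost every curve. -/
def IsWeakUpperGradient (p : ℝ) (μ : Measure X) (f : X → EReal) (g : X → ℝ≥0∞) : Prop :=
  Measurable g ∧ ZeroModulus p μ {γ : Curve X | ¬ UGOn f g γ}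

/-- The energy `∫_X g_u^p dμ` of the minimal `p`-weak upper gradient of `u`, expressed as
the infimum of `∫_X g^p dμ` over all `p`-weak upper gradients `g` of `u`
(`= ∞` if `u` has no `p`-weak upper gradient). -/
def gradEnergy (p : ℝ) (μ : Measure X) (u : X → EReal) : ℝ≥0∞ :=
  ⨅ (g : X → ℝ≥0∞) (_ : IsWeakUpperGradient p μ u g), ∫⁻ x, g x ^ p ∂μ

/-- The Newtonian energy `‖u‖_{N^{1,p}(X)}^p = ∫_X |u|^p dμ + ∫_X g_u^p dμ`. -/
def newtonianEnergy (p : ℝ) (μ : Measure X) (u : X → EReal) : ℝ≥0∞ :=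
  (∫⁻ x, (u x).abs ^ p ∂μ) + gradEnergy p μ u

/-- Membership in the Newtonian space `N^{1,p}(X)` (measurability is with respect to the
completion of the Borel σ-algebra, i.e. a.e.-measurability). -/
def MemNewtonian (p : ℝ) (μ : Measure X) (u : X → EReal) : Prop :=
  AEMeasurable u μ ∧ newtonianEnergy p μ u < ⊤

/-- Membership in `N^{1,p}_0(E)`, members being regarded as functions on all of `X`
that vanish outside `E`. -/
def MemNewtonian0 (p : ℝ) (μ : Measure X) (E : Set X) (u : X → EReal) : Prop :=
  MemNewtonian p μ u ∧ ∀ x ∉ E, u x = 0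

/-- The Sobolev capacity `C_p(A)`. -/
def sobolevCapacity (p : ℝ) (μ : Measure X) (A : Set X) : ℝ≥0∞ :=
  ⨅ (u : X → EReal) (_ : MemNewtonian p μ u ∧ ∀ x ∈ A, u x = 1), newtonianEnergy p μ u

/-- The variational capacity `cap_p(A, E)`. -/
def varCapacity (p : ℝ) (μ : Measure X) (A E : Set X) : ℝ≥0∞ :=
  ⨅ (u : X → EReal) (_ : MemNewtonian0 p μ E u ∧ ∀ x ∈ A, 1 ≤ u x), gradEnergy p μ u

/-- A function is quasicontinuous if outside open sets of arbitrarily small Sobolev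
capacity it is real-valued and continuous. -/
def QuasicontinuousFun (p : ℝ) (μ : Measure X) (u : X → EReal) : Prop :=
  ∀ ε : ℝ≥0∞, 0 < ε → ∃ G : Set X, IsOpen G ∧ sobolevCapacity p μ G < ε ∧
    (∀ x ∈ Gᶜ, u x ≠ ⊤ ∧ u x ≠ ⊥) ∧ ContinuousOn u Gᶜ

/-- The capacity `~cap_p(A,E)`: the infimum of `cap_p(G,E)` over all relatively open
subsets `G` of `E` containing `A`. -/
def varCapacityT (p : ℝ) (μ : Measure X) (A E : Set X) : ℝ≥0∞ :=
  ⨅ (G : Set X) (_ : A ⊆ G ∧ G ⊆ E ∧ ∃ U : Set X, IsOpen U ∧ G = U ∩ E),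
    varCapacity p μ G E


set_option linter.unusedSectionVars false

theorem ugDiff_coe (a b : ℝ) : ugDiff a b = edist a b := by
  unfold ugDiff
  rw [if_neg (by simp [EReal.abs_def]), ← EReal.coe_sub, EReal.abs_def, edist_dist, Real.dist_eq]

theorem uGOn_coe {f : X → ℝ} {g : X → ℝ≥0∞} {γ : Curve X} :
    UGOn (fun x => (f x : EReal)) g γ ↔
      edist (f (γ.toFun 0)) (f (γ.toFun γ.len)) ≤ γ.integral g := by
  unfold UGOn
  rw [ugDiff_coe]

/-- Truncation of an extended real number to the unit interval. -/
def clamp (x : EReal) : ℝ := (max 0 (min x 1)).toReal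

theorem coe_clamp (x : EReal) : (clamp x : EReal) = max 0 (min x 1) := by
  refine EReal.coe_toReal (ne_of_lt ?_) (ne_of_gt ?_)
  · exact lt_of_le_of_lt (max_le zero_le_one (min_le_right _ _)) (EReal.coe_lt_top 1)
  · exact lt_of_lt_of_le (EReal.bot_lt_coe 0) (le_max_left _ _)

theorem clamp_nonneg (x : EReal) : 0 ≤ clamp x := by
  rw [← EReal.coe_le_coe_iff, coe_clamp]
  exact le_max_left _ _

theorem clamp_le_one (x : EReal) : clamp x ≤ 1 := by
  rw [← EReal.coe_le_coe_iff, coe_clamp]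
  exact max_le zero_le_one (min_le_right _ _)

theorem clamp_zero : clamp 0 = 0 := by simp [clamp]

theorem clamp_one : clamp 1 = 1 := by simp [clamp]

theorem le_clamp {x : EReal} {r : ℝ} (hr : r ≤ 1) (h : (r : EReal) ≤ x) : r ≤ clamp x := by
  rw [← EReal.coe_le_coe_iff, coe_clamp]
  exact le_max_of_le_right (le_min h (by exact_mod_cast hr))

theorem measurable_clamp : Measurable clamp :=
  measurable_ereal_toReal.comp (measurable_const.max (measurable_id.min measurable_const))

theorem clamp_coe (a : ℝ) : clamp a = max 0 (min a 1) := by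
  rw [← EReal.coe_eq_coe_iff, coe_clamp]
  rfl

theorem edist_clamp_le_ugDiff (a b : EReal) : edist (clamp a) (clamp b) ≤ ugDiff a b := by
  by_cases h : a.abs = ⊤ ∨ b.abs = ⊤
  · simp [ugDiff, h]
  · push Not at h
    obtain ⟨ha, hb⟩ := h
    induction a using EReal.rec with
    | bot => simp at ha
    | top => simp at ha
    | coe a =>
      induction b using EReal.rec with
      | bot => simp at hb
      | top => simp at hb
      | coe b =>
        rw [ugDiff_coe, clamp_coe, clamp_coe, edist_dist, edist_dist, Real.dist_eq, Real.dist_eq]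
        refine ENNReal.ofReal_le_ofReal ?_
        refine (abs_max_sub_max_le_max _ _ _ _).trans ?_
        refine max_le (by simp) ((abs_min_sub_min_le_max _ _ _ _).trans ?_)
        simp

theorem ofReal_clamp_le_abs (x : EReal) : ENNReal.ofReal (clamp x) ≤ x.abs := by
  have h := edist_clamp_le_ugDiff x 0
  unfold ugDiff at h
  split_ifs at h with h'
  · rcases h' with h' | h'
    · simp [h']
    · simp at h'
  · rwa [clamp_zero, sub_zero, edist_dist, Real.dist_eq, sub_zero,
      abs_of_nonneg (clamp_nonneg x)] at h

theorem ZeroModulus.mono {p : ℝ} {μ : Measure X} {Γ Γ' : Set (Curve X)} (h : ZeroModulus p μ Γ)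
    (hsub : Γ' ⊆ Γ) : ZeroModulus p μ Γ' := by
  obtain ⟨ρ, h1, h2, h3⟩ := h
  exact ⟨ρ, h1, h2, fun γ hγ => h3 γ (hsub hγ)⟩

theorem Curve.integral_mono (γ : Curve X) {g h : X → ℝ≥0∞} (hgh : g ≤ h) :
    γ.integral g ≤ γ.integral h :=
  lintegral_mono fun _ => hgh _

theorem Curve.const_mul_integral_le (γ : Curve X) (c : ℝ≥0∞) (g : X → ℝ≥0∞) :
    c * γ.integral g ≤ γ.integral (fun x => c * g x) :=
  lintegral_const_mul_le _ _

theorem ZeroModulus.exists_small {p : ℝ} (hp : 0 < p) {μ : Measure X} {Γ : Set (Curve X)}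
    (h : ZeroModulus p μ Γ) {δ : ℝ≥0∞} (hδ : δ ≠ 0) :
    ∃ ρ : X → ℝ≥0∞, Measurable ρ ∧ ∫⁻ x, ρ x ^ p ∂μ ≤ δ ∧ ∀ γ ∈ Γ, γ.integral ρ = ⊤ := by
  obtain ⟨ρ, h1, h2, h3⟩ := h
  set I := ∫⁻ x, ρ x ^ p ∂μ with hI
  set k : ℝ≥0∞ := (δ / (I + 1)) ^ (1 / p) with hk
  have hI1 : I + 1 ≠ ⊤ := by simp [h2.ne]
  have hk0 : k ≠ 0 := by
    rw [hk, Ne, ENNReal.rpow_eq_zero_iff]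
    push Not
    refine ⟨fun h => ?_, fun _ => by positivity⟩
    exact absurd h (ENNReal.div_ne_zero.2 ⟨hδ, hI1⟩)
  refine ⟨fun x => k * ρ x, h1.const_mul k, ?_, fun γ hγ => ?_⟩
  · simp_rw [ENNReal.mul_rpow_of_nonneg _ _ hp.le]
    rw [lintegral_const_mul _ (h1.pow_const p), ← hI, hk, ← ENNReal.rpow_mul,
      one_div_mul_cancel hp.ne', ENNReal.rpow_one]
    calc δ / (I + 1) * I ≤ (I + 1) * (δ / (I + 1)) := by
          rw [mul_comm]
          gcongr
          exact le_self_add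
      _ ≤ δ := ENNReal.mul_div_le
  · have := γ.const_mul_integral_le k ρ
    rw [h3 γ hγ, ENNReal.mul_top hk0] at this
    exact top_le_iff.1 this

theorem lintegral_iSup_rpow_le {p : ℝ} (hp : 0 < p) {μ : Measure X} {g : ℕ → X → ℝ≥0∞}
    (hg : ∀ n, Measurable (g n)) :
    ∫⁻ x, (⨆ n, g n x) ^ p ∂μ ≤ ∑' n, ∫⁻ x, g n x ^ p ∂μ := by
  rw [← lintegral_tsum fun n => ((hg n).pow_const p).aemeasurable]
  refine lintegral_mono fun x => ?_
  rw [← ENNReal.le_rpow_inv_iff hp]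
  refine iSup_le fun n => ?_
  rw [ENNReal.le_rpow_inv_iff hp]
  exact ENNReal.le_tsum (f := fun n => g n x ^ p) n

theorem zeroModulus_iUnion {p : ℝ} (hp : 0 < p) {μ : Measure X} {Γ : ℕ → Set (Curve X)}
    (h : ∀ n, ZeroModulus p μ (Γ n)) : ZeroModulus p μ (⋃ n, Γ n) := by
  obtain ⟨δ, hδ, hsum⟩ := ENNReal.exists_pos_sum_of_countable (one_ne_zero (α := ℝ≥0∞)) ℕ
  choose ρ h1 h2 h3 using fun n =>
    (h n).exists_small hp (δ := δ n) (by exact_mod_cast (hδ n).ne')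
  refine ⟨fun x => ⨆ n, ρ n x, Measurable.iSup h1, ?_, fun γ hγ => ?_⟩
  · calc _ ≤ ∑' n, ∫⁻ x, ρ n x ^ p ∂μ := lintegral_iSup_rpow_le hp h1
      _ ≤ ∑' n, (δ n : ℝ≥0∞) := ENNReal.tsum_le_tsum h2
      _ < ⊤ := hsum.trans ENNReal.one_lt_top
  · obtain ⟨n, hn⟩ := mem_iUnion.1 hγ
    refine top_le_iff.1 ?_
    rw [← h3 n γ hn]
    exact γ.integral_mono fun x => le_iSup (fun n => ρ n x) n

theorem edist_ciSup_le {ι : Type*} [Nonempty ι] {a b : ι → ℝ} (ha : BddAbove (range a))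
    (hb : BddAbove (range b)) {D : ℝ≥0∞} (h : ∀ i, edist (a i) (b i) ≤ D) :
    edist (⨆ i, a i) (⨆ i, b i) ≤ D := by
  rcases eq_or_ne D ⊤ with rfl | hD
  · exact le_top
  have h' : ∀ i, |a i - b i| ≤ D.toReal := fun i => by
    have := h i
    rwa [edist_dist, Real.dist_eq, ENNReal.ofReal_le_iff_le_toReal hD] at this
  rw [edist_dist, Real.dist_eq, ENNReal.ofReal_le_iff_le_toReal hD, abs_sub_le_iff]
  constructor
  · rw [sub_le_iff_le_add]
    refine ciSup_le fun i => ?_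
    linarith [(abs_sub_le_iff.1 (h' i)).1, le_ciSup hb i]
  · rw [sub_le_iff_le_add]
    refine ciSup_le fun i => ?_
    linarith [(abs_sub_le_iff.1 (h' i)).2, le_ciSup ha i]

theorem IsWeakUpperGradient.ciSup {p : ℝ} (hp : 0 < p) {μ : Measure X} {f : ℕ → X → ℝ}
    {g : ℕ → X → ℝ≥0∞} (hf : ∀ x, BddAbove (range fun n => f n x))
    (h : ∀ n, IsWeakUpperGradient p μ (fun x => (f n x : EReal)) (g n)) :
    IsWeakUpperGradient p μ (fun x => ((⨆ n, f n x : ℝ) : EReal)) (fun x => ⨆ n, g n x) := by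
  refine ⟨Measurable.iSup fun n => (h n).1,
    (zeroModulus_iUnion hp fun n => (h n).2).mono fun γ hγ => ?_⟩
  by_contra hcon
  simp only [mem_iUnion, mem_ofPred_eq, not_exists, not_not] at hcon hγ
  rw [uGOn_coe] at hγ
  refine hγ (edist_ciSup_le (hf _) (hf _) fun n => (uGOn_coe.1 (hcon n)).trans ?_)
  exact γ.integral_mono fun x => le_iSup (fun n => g n x) n

/-- The restriction of a curve to the parameter interval `[a, b]`. -/
def Curve.sub (γ : Curve X) {a b : ℝ} (ha : 0 ≤ a) (hab : a < b) (hb : b ≤ γ.len) : Curve X where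
  len := b - a
  len_pos := sub_pos.2 hab
  toFun t := γ.toFun (a + t)
  continuousOn := by
    refine γ.continuousOn.comp (by fun_prop) fun t ht => ?_
    exact ⟨by linarith [ht.1], by linarith [ht.2]⟩
  arclength s t hs ht hst := by
    have h1 := eVariationOn.comp_eq_of_monotoneOn γ.toFun (t := Icc s t) (fun t => a + t)
      (fun x _ y _ hxy => by simpa using hxy)
    have h2 := γ.arclength (a + s) (a + t) ⟨by linarith [hs.1], by linarith [hs.2]⟩
      ⟨by linarith [ht.1], by linarith [ht.2]⟩ (by linarith)
    rw [image_const_add_Icc, h2] at h1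
    rw [show t - s = a + t - (a + s) by ring, ← h1]
    rfl
  nonconstant := by
    by_contra hcon
    push Not at hcon
    have h2 := γ.arclength a b ⟨ha, by linarith⟩ ⟨by linarith, hb⟩ hab.le
    rw [eVariationOn.constant_on] at h2
    · exact absurd h2.symm (by simpa using hab)
    · rintro _ ⟨s, hs, rfl⟩ _ ⟨t, ht, rfl⟩
      have := hcon (s - a) ⟨by linarith [hs.1], by linarith [hs.2]⟩
        (t - a) ⟨by linarith [ht.1], by linarith [ht.2]⟩
      simpa using this

theorem Curve.integral_sub (γ : Curve X) {a b : ℝ} (ha : 0 ≤ a) (hab : a < b) (hb : b ≤ γ.len)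
    (g : X → ℝ≥0∞) : (γ.sub ha hab hb).integral g = ∫⁻ t in Icc a b, g (γ.toFun t) := by
  have hmp : MeasurePreserving (fun t : ℝ => a + t) volume volume :=
    measurePreserving_add_left volume a
  have := hmp.setLIntegral_comp_emb (measurableEmbedding_addLeft a)
    (fun t => g (γ.toFun t)) (Icc 0 (b - a))
  rw [image_const_add_Icc, add_zero, add_sub_cancel] at this
  exact this.symm ▸ rfl

theorem Curve.edist_le (γ : Curve X) {a b : ℝ} (ha : 0 ≤ a) (hab : a ≤ b) (hb : b ≤ γ.len) :
    edist (γ.toFun a) (γ.toFun b) ≤ ENNReal.ofReal (b - a) := by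
  rw [← γ.arclength a b ⟨ha, by linarith⟩ ⟨by linarith, hb⟩ hab]
  exact eVariationOn.edist_le _ ⟨le_rfl, hab⟩ ⟨hab, le_rfl⟩

theorem setLIntegral_Icc_add {a m b : ℝ} (ham : a ≤ m) (hmb : m ≤ b) (f : ℝ → ℝ≥0∞) :
    (∫⁻ t in Icc a m, f t) + ∫⁻ t in Icc m b, f t = ∫⁻ t in Icc a b, f t := by
  rw [← setLIntegral_congr (Ioc_ae_eq_Icc (a := m) (b := b)),
    ← lintegral_union measurableSet_Ioc ?_, Icc_union_Ioc_eq_Icc ham hmb]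
  exact disjoint_left.2 fun x hx hx' => absurd hx.2 (not_le.2 hx'.1)

theorem edist_mul_le {a b c d : ℝ} (hc : 0 ≤ c) (hb0 : 0 ≤ b) (hb : b ≤ 1) :
    edist (a * c) (b * d) ≤ edist c d + ENNReal.ofReal c * edist a b := by
  simp only [edist_dist, Real.dist_eq]
  rw [← ENNReal.ofReal_mul hc, ← ENNReal.ofReal_add (abs_nonneg _) (by positivity)]
  refine ENNReal.ofReal_le_ofReal ?_
  calc |a * c - b * d| = |b * (c - d) + c * (a - b)| := by ring_nf
    _ ≤ |b * (c - d)| + |c * (a - b)| := abs_add_le _ _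
    _ = b * |c - d| + c * |a - b| := by rw [abs_mul, abs_mul, abs_of_nonneg hb0, abs_of_nonneg hc]
    _ ≤ |c - d| + c * |a - b| := by
      gcongr
      exact mul_le_of_le_one_left (abs_nonneg _) hb

section Product

variable {γ : Curve X} {φ η : X → ℝ} {g h : X → ℝ≥0∞} {L : ℝ≥0}

theorem Curve.edist_mul_le_of_short (hφ : ∀ x, 0 ≤ φ x) (hη0 : ∀ x, 0 ≤ η x)
    (hη1 : ∀ x, η x ≤ 1) (hL : LipschitzWith L η) (hh : ∀ x, ENNReal.ofReal (φ x) ≤ h x)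
    (hg : ∀ a b, 0 ≤ a → a < b → b ≤ γ.len →
      edist (φ (γ.toFun a)) (φ (γ.toFun b)) ≤ ∫⁻ t in Icc a b, g (γ.toFun t))
    {a b : ℝ} (ha : 0 ≤ a) (hab : a < b) (hb : b ≤ γ.len) (hs : L * (b - a) ≤ 1) :
    edist (η (γ.toFun a) * φ (γ.toFun a)) (η (γ.toFun b) * φ (γ.toFun b)) ≤
      ∫⁻ t in Icc a b, (2 * g (γ.toFun t) + L * h (γ.toFun t)) := by
  set G := ∫⁻ t in Icc a b, g (γ.toFun t) with hG
  set H := ∫⁻ t in Icc a b, h (γ.toFun t) with hH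
  have key : ENNReal.ofReal (φ (γ.toFun a)) * ENNReal.ofReal (b - a) ≤
      H + G * ENNReal.ofReal (b - a) := by
    calc ENNReal.ofReal (φ (γ.toFun a)) * ENNReal.ofReal (b - a)
        = ∫⁻ _ in Icc a b, ENNReal.ofReal (φ (γ.toFun a)) := by simp
      _ ≤ ∫⁻ t in Icc a b, (h (γ.toFun t) + G) := by
        refine setLIntegral_mono' measurableSet_Icc fun t ht => ?_
        rcases eq_or_lt_of_le ht.1 with rfl | hat
        · exact (hh _).trans le_self_add
        have h1 := (hg a t ha hat (ht.2.trans hb)).trans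
          (lintegral_mono_set (Icc_subset_Icc_right ht.2))
        have h2 : ENNReal.ofReal (φ (γ.toFun a)) ≤
            ENNReal.ofReal (φ (γ.toFun t)) + edist (φ (γ.toFun a)) (φ (γ.toFun t)) := by
          rw [edist_dist, ← ENNReal.ofReal_add (hφ _) dist_nonneg, Real.dist_eq]
          refine ENNReal.ofReal_le_ofReal ?_
          linarith [le_abs_self (φ (γ.toFun a) - φ (γ.toFun t))]
        exact h2.trans (add_le_add (hh _) h1)
      _ = H + G * ENNReal.ofReal (b - a) := by
        rw [lintegral_add_right _ measurable_const]
        simp [hH]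
  have hLs : (L : ℝ≥0∞) * ENNReal.ofReal (b - a) ≤ 1 := by
    rw [← ENNReal.ofReal_coe_nnreal, ← ENNReal.ofReal_mul (by positivity)]
    exact ENNReal.ofReal_le_one.2 hs
  have hη : edist (η (γ.toFun a)) (η (γ.toFun b)) ≤ L * ENNReal.ofReal (b - a) :=
    (hL _ _).trans (by gcongr; exact γ.edist_le ha hab.le hb)
  calc _ ≤ edist (φ (γ.toFun a)) (φ (γ.toFun b)) +
        ENNReal.ofReal (φ (γ.toFun a)) * edist (η (γ.toFun a)) (η (γ.toFun b)) :=
        edist_mul_le (hφ _) (hη0 _) (hη1 _)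
    _ ≤ G + ENNReal.ofReal (φ (γ.toFun a)) * (L * ENNReal.ofReal (b - a)) := by
        gcongr
        exact hg a b ha hab hb
    _ = G + L * (ENNReal.ofReal (φ (γ.toFun a)) * ENNReal.ofReal (b - a)) := by ring
    _ ≤ G + L * (H + G * ENNReal.ofReal (b - a)) := by gcongr
    _ = G + (L * ENNReal.ofReal (b - a)) * G + L * H := by ring
    _ ≤ G + 1 * G + L * H := by gcongr
    _ = 2 * G + L * H := by ring
    _ ≤ (∫⁻ t in Icc a b, 2 * g (γ.toFun t)) + ∫⁻ t in Icc a b, L * h (γ.toFun t) :=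
        add_le_add (lintegral_const_mul_le _ _) (lintegral_const_mul_le _ _)
    _ ≤ _ := le_lintegral_add _ _

theorem Curve.edist_mul_le (hφ : ∀ x, 0 ≤ φ x) (hη0 : ∀ x, 0 ≤ η x)
    (hη1 : ∀ x, η x ≤ 1) (hL : LipschitzWith L η) (hh : ∀ x, ENNReal.ofReal (φ x) ≤ h x)
    (hg : ∀ a b, 0 ≤ a → a < b → b ≤ γ.len →
      edist (φ (γ.toFun a)) (φ (γ.toFun b)) ≤ ∫⁻ t in Icc a b, g (γ.toFun t)) (n : ℕ)
    {a b : ℝ} (ha : 0 ≤ a) (hab : a < b) (hb : b ≤ γ.len) (hs : L * (b - a) ≤ 2 ^ n) :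
    edist (η (γ.toFun a) * φ (γ.toFun a)) (η (γ.toFun b) * φ (γ.toFun b)) ≤
      ∫⁻ t in Icc a b, (2 * g (γ.toFun t) + L * h (γ.toFun t)) := by
  induction n generalizing a b with
  | zero =>
    exact Curve.edist_mul_le_of_short hφ hη0 hη1 hL hh hg ha hab hb (by simpa using hs)
  | succ n ih =>
    have hs' : L * ((b - a) / 2) ≤ (2 : ℝ) ^ n := by
      rw [pow_succ] at hs
      linarith
    rw [← setLIntegral_Icc_add (m := (a + b) / 2) (by linarith) (by linarith)]
    refine (edist_triangle _ (η (γ.toFun ((a + b) / 2)) * φ (γ.toFun ((a + b) / 2))) _).trans ?_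
    refine add_le_add (ih ha (by linarith) (by linarith) ?_)
      (ih (by linarith) (by linarith) hb ?_)
    · rwa [show (a + b) / 2 - a = (b - a) / 2 by ring]
    · rwa [show b - (a + b) / 2 = (b - a) / 2 by ring]

end Product

theorem IsWeakUpperGradient.mul_clamp {p : ℝ} {μ : Measure X} {v : X → EReal} {η : X → ℝ}
    {g h : X → ℝ≥0∞} {L : ℝ≥0} (hg : IsWeakUpperGradient p μ v g) (hη0 : ∀ x, 0 ≤ η x)
    (hη1 : ∀ x, η x ≤ 1) (hL : LipschitzWith L η) (hm : Measurable h)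
    (hh : ∀ x, ENNReal.ofReal (clamp (v x)) ≤ h x) :
    IsWeakUpperGradient p μ (fun x => ((η x * clamp (v x) : ℝ) : EReal))
      (fun x => 2 * g x + L * h x) := by
  refine ⟨(hg.1.const_mul 2).add (hm.const_mul _), ?_⟩
  obtain ⟨ρ, h1, h2, h3⟩ := hg.2
  refine ⟨ρ, h1, h2, fun γ hγ => ?_⟩
  by_contra hρ
  refine hγ (uGOn_coe.2 ?_)
  obtain ⟨n, hn⟩ := pow_unbounded_of_one_lt (L * (γ.len - 0)) (one_lt_two (α := ℝ))
  refine Curve.edist_mul_le (φ := fun x => clamp (v x)) (fun x => clamp_nonneg _) hη0 hη1 hL hh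
    (fun a b ha hab hb => ?_) n le_rfl γ.len_pos le_rfl hn.le
  have hgood : UGOn v g (γ.sub ha hab hb) := by
    by_contra hbad
    have := h3 _ hbad
    rw [γ.integral_sub] at this
    refine hρ (top_le_iff.1 ?_)
    rw [← this]
    exact lintegral_mono_set (Icc_subset_Icc ha hb)
  rw [UGOn, γ.integral_sub] at hgood
  refine (edist_clamp_le_ugDiff _ _).trans (le_trans (le_of_eq ?_) hgood)
  simp [Curve.sub]

theorem IsWeakUpperGradient.const_mul_clamp {p : ℝ} {μ : Measure X} {v : X → EReal}
    {g : X → ℝ≥0∞} (hg : IsWeakUpperGradient p μ v g) (c : ℝ≥0) :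
    IsWeakUpperGradient p μ (fun x => ((c * clamp (v x) : ℝ) : EReal)) (fun x => c * g x) := by
  refine ⟨hg.1.const_mul _, hg.2.mono fun γ hγ hgood => hγ (uGOn_coe.2 ?_)⟩
  refine le_trans ?_ (γ.const_mul_integral_le _ _)
  refine le_trans ?_ (mul_le_mul_right (le_trans (edist_clamp_le_ugDiff _ _) hgood) (c : ℝ≥0∞))
  simp only [edist_dist, Real.dist_eq]
  rw [← mul_sub, abs_mul, abs_of_nonneg c.coe_nonneg, ENNReal.ofReal_mul c.coe_nonneg,
    ENNReal.ofReal_coe_nnreal]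

theorem exists_measurable_ge_ae_eq {μ : Measure X} {f : X → ℝ≥0∞} (hf : AEMeasurable f μ) :
    ∃ h : X → ℝ≥0∞, Measurable h ∧ (∀ x, f x ≤ h x) ∧ h =ᵐ[μ] f := by
  set N := toMeasurable μ {x | ¬ f x = hf.mk f x} with hN
  have hN0 : μ N = 0 := by
    rw [hN, measure_toMeasurable]
    exact hf.ae_eq_mk
  refine ⟨fun x => max (hf.mk f x) (N.indicator (fun _ => ⊤) x),
    hf.measurable_mk.max (measurable_const.indicator (measurableSet_toMeasurable _ _)),
    fun x => ?_, ?_⟩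
  · by_cases hx : f x = hf.mk f x
    · exact le_max_of_le_left hx.le
    · have : x ∈ N := subset_toMeasurable _ _ hx
      simp [this]
  · have : ∀ᵐ x ∂μ, x ∉ N := measure_eq_zero_iff_ae_notMem.1 hN0
    filter_upwards [this, hf.ae_eq_mk] with x hx hx'
    simp [hx, hx']

/-- Multiplying the truncation of a Newtonian function by a Lipschitz cutoff increases the energy
at most by a constant factor. -/
theorem exists_weakUpperGradient_mul_clamp {p : ℝ} (hp : 1 < p) {μ : Measure X} {v : X → EReal}
    {η : X → ℝ} {L : ℝ≥0} (hv : AEMeasurable v μ) (hη0 : ∀ x, 0 ≤ η x) (hη1 : ∀ x, η x ≤ 1)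
    (hL : LipschitzWith L η) {ε : ℝ≥0∞} (hε : newtonianEnergy p μ v < ε) :
    ∃ g : X → ℝ≥0∞, IsWeakUpperGradient p μ (fun x => ((η x * clamp (v x) : ℝ) : EReal)) g ∧
      ∫⁻ x, g x ^ p ∂μ ≤ 2 ^ (p - 1) * (2 ^ p + (L : ℝ≥0∞) ^ p) * ε := by
  have hp0 : 0 < p := one_pos.trans hp
  have hfin : gradEnergy p μ v < ε := lt_of_le_of_lt le_add_self hε
  have hfin' : ∫⁻ x, (v x).abs ^ p ∂μ ≤ ε := le_trans le_self_add hε.le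
  simp only [gradEnergy, iInf_lt_iff] at hfin
  obtain ⟨g, hg, hgε⟩ := hfin
  have hm : AEMeasurable (fun x => ENNReal.ofReal (clamp (v x))) μ :=
    (measurable_clamp.comp_aemeasurable hv).ennreal_ofReal
  obtain ⟨h, hmeas, hge, hae⟩ := exists_measurable_ge_ae_eq hm
  refine ⟨_, hg.mul_clamp hη0 hη1 hL hmeas hge, ?_⟩
  have hh : ∫⁻ x, h x ^ p ∂μ ≤ ε := by
    refine le_trans (le_of_eq (lintegral_congr_ae ?_)) ((lintegral_mono fun x =>
      ENNReal.rpow_le_rpow (ofReal_clamp_le_abs (v x)) hp0.le).trans hfin')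
    filter_upwards [hae] with x hx
    rw [hx]
  calc ∫⁻ x, (2 * g x + L * h x) ^ p ∂μ
      ≤ ∫⁻ x, 2 ^ (p - 1) * (2 ^ p * g x ^ p + (L : ℝ≥0∞) ^ p * h x ^ p) ∂μ := by
        refine lintegral_mono fun x => ?_
        rw [← ENNReal.mul_rpow_of_nonneg _ _ hp0.le, ← ENNReal.mul_rpow_of_nonneg _ _ hp0.le]
        exact ENNReal.rpow_add_le_mul_rpow_add_rpow _ _ hp.le
    _ = 2 ^ (p - 1) * (2 ^ p * (∫⁻ x, g x ^ p ∂μ) + (L : ℝ≥0∞) ^ p * ∫⁻ x, h x ^ p ∂μ) := by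
        have h1 := hg.1.pow_const p
        have h2 := hmeas.pow_const p
        have h3 : Measurable fun x => 2 ^ p * g x ^ p + (L : ℝ≥0∞) ^ p * h x ^ p :=
          (h1.const_mul _).add (h2.const_mul _)
        rw [lintegral_const_mul _ h3,
          lintegral_add_left (h1.const_mul _), lintegral_const_mul _ h1, lintegral_const_mul _ h2]
    _ ≤ 2 ^ (p - 1) * (2 ^ p * ε + (L : ℝ≥0∞) ^ p * ε) := by
        have := hgε.le
        gcongr
    _ = _ := by ring

/-- Near a set `A` at positive distance from the complement of `E`, a Newtonian function which is
at least `1` on `A` is almost at least `1` on an open set, up to a correction of small energy. -/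
theorem exists_open_correction {p : ℝ} (hp : 1 < p) {μ : Measure X} {E A : Set X}
    {u : X → EReal} (hu : QuasicontinuousFun p μ u) (huA : ∀ x ∈ A, 1 ≤ u x)
    {r : ℝ} (hr : 0 < r) (hAr : ∀ x ∈ A, ENNReal.ofReal r < infEDist x Eᶜ)
    {s : ℝ} (hs : s < 1) {δ : ℝ≥0∞} (hδ : δ ≠ 0) :
    ∃ (G : Set X) (f : X → ℝ) (g : X → ℝ≥0∞), IsOpen G ∧ A ⊆ G ∧ G ⊆ E ∧
      AEMeasurable f μ ∧ (∀ x, 0 ≤ f x) ∧ (∀ x, f x ≤ 1) ∧ (∀ x ∉ E, f x = 0) ∧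
      (∀ x ∈ G, (s : EReal) < u x ∨ f x = 1) ∧
      IsWeakUpperGradient p μ (fun x => (f x : EReal)) g ∧ ∫⁻ x, g x ^ p ∂μ ≤ δ := by
  set D : Set X := {x | ENNReal.ofReal r < infEDist x Eᶜ} with hD
  have hDo : IsOpen D := isOpen_lt continuous_const continuous_infEDist
  set η : X → ℝ := fun x => (thickenedIndicator hr D x : ℝ) with hη
  obtain ⟨L, hL⟩ : ∃ L : ℝ≥0, LipschitzWith L η :=
    ⟨_, fun x y => lipschitzWith_thickenedIndicator hr D x y⟩
  have hη0 : ∀ x, 0 ≤ η x := fun x => NNReal.coe_nonneg _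
  have hη1 : ∀ x, η x ≤ 1 := fun x => by
    exact_mod_cast thickenedIndicator_le_one hr D x
  have hηD : ∀ x ∈ D, η x = 1 := fun x hx => by
    rw [hη]
    exact congrArg NNReal.toReal (thickenedIndicator_one hr D hx)
  have hηE : ∀ x ∉ E, η x = 0 := fun x hx => by
    have : x ∉ thickening r D := fun hx' => by
      obtain ⟨z, hz, hxz⟩ := mem_thickening_iff.1 hx'
      have h1 : infEDist z Eᶜ ≤ edist z x := infEDist_le_edist_of_mem hx
      have h2 : edist z x < ENNReal.ofReal r := by
        rw [edist_comm, edist_dist]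
        exact (ENNReal.ofReal_lt_ofReal_iff hr).2 hxz
      exact absurd (h1.trans_lt h2) (not_lt.2 hz.le)
    rw [hη]
    exact congrArg NNReal.toReal (thickenedIndicator_zero hr D this)
  set K : ℝ≥0∞ := 2 ^ (p - 1) * (2 ^ p + (L : ℝ≥0∞) ^ p) with hK
  have hKtop : K ≠ ⊤ := by
    refine ENNReal.mul_ne_top (by simp) (ENNReal.add_ne_top.2 ⟨by simp, ?_⟩)
    exact ENNReal.rpow_ne_top_of_nonneg (by linarith) ENNReal.coe_ne_top
  obtain ⟨V, hVo, hVε, -, hVc⟩ := hu (δ / K) (ENNReal.div_pos hδ hKtop)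
  simp only [sobolevCapacity, iInf_lt_iff] at hVε
  obtain ⟨v, ⟨hvN, hv1⟩, hvε⟩ := hVε
  obtain ⟨g, hg, hgδ⟩ := exists_weakUpperGradient_mul_clamp hp hvN.1 hη0 hη1 hL hvε
  obtain ⟨U, hUo, hU⟩ := (continuousOn_iff'.1 hVc) (Ioi (s : EReal)) isOpen_Ioi
  have hcover : ∀ x, x ∈ U ∪ V → (s : EReal) < u x ∨ x ∈ V := fun x hx => by
    by_cases hxV : x ∈ V
    · exact Or.inr hxV
    · have : x ∈ U ∩ Vᶜ := ⟨hx.resolve_right hxV, hxV⟩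
      rw [← hU] at this
      exact Or.inl this.1
  refine ⟨D ∩ (U ∪ V), fun x => η x * clamp (v x), g, hDo.inter (hUo.union hVo), ?_, ?_, ?_,
    ?_, ?_, ?_, ?_, hg, hgδ.trans ENNReal.mul_div_le⟩
  · refine fun x hx => ⟨hAr x hx, ?_⟩
    by_cases hxV : x ∈ V
    · exact Or.inr hxV
    · have : x ∈ u ⁻¹' Ioi (s : EReal) ∩ Vᶜ :=
        ⟨lt_of_lt_of_le (by exact_mod_cast hs) (huA x hx), hxV⟩
      rw [hU] at this
      exact Or.inl this.1
  · refine fun x hx => by_contra fun hxE => ?_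
    have h1 := hηD x hx.1
    rw [hηE x hxE] at h1
    exact zero_ne_one h1
  · exact hL.continuous.measurable.aemeasurable.mul (measurable_clamp.comp_aemeasurable hvN.1)
  · exact fun x => mul_nonneg (hη0 x) (clamp_nonneg _)
  · exact fun x => mul_le_one₀ (hη1 x) (clamp_nonneg _) (clamp_le_one _)
  · intro x hx
    simp [hηE x hx]
  · rintro x ⟨hxD, hx⟩
    refine (hcover x hx).imp_right fun hxV => ?_
    simp [hηD x hxD, hv1 x hxV, clamp_one]

theorem gradEnergy_le {p : ℝ} {μ : Measure X} {u : X → EReal} {g : X → ℝ≥0∞}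
    (hg : IsWeakUpperGradient p μ u g) : gradEnergy p μ u ≤ ∫⁻ x, g x ^ p ∂μ :=
  iInf₂_le g hg

theorem memNewtonian0_of_bounded {p : ℝ} (hp : 0 < p) {μ : Measure X}
    (hball : ∀ (x : X) (r : ℝ), 0 < r → μ (ball x r) < ⊤) {E : Set X}
    (hE : Bornology.IsBounded E) {w : X → ℝ} (hw : AEMeasurable w μ) {c : ℝ}
    (hwc : ∀ x, |w x| ≤ c) (hwE : ∀ x ∉ E, w x = 0)
    (hfin : gradEnergy p μ (fun x => (w x : EReal)) < ⊤) :
    MemNewtonian0 p μ E (fun x => (w x : EReal)) := by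
  refine ⟨⟨hw.coe_real_ereal, ENNReal.add_lt_top.2 ⟨?_, hfin⟩⟩, fun x hx => by simp [hwE x hx]⟩
  rcases E.eq_empty_or_nonempty with rfl | ⟨x₀, -⟩
  · simp [hwE, hp]
  obtain ⟨r, hr, hsub⟩ := hE.subset_ball_lt 0 x₀
  calc ∫⁻ x, (w x : EReal).abs ^ p ∂μ
      ≤ ∫⁻ x, (ball x₀ r).indicator (fun _ => ENNReal.ofReal c ^ p) x ∂μ := by
        refine lintegral_mono fun x => ?_
        by_cases hx : x ∈ ball x₀ r
        · rw [indicator_of_mem hx, EReal.abs_def]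
          exact ENNReal.rpow_le_rpow (ENNReal.ofReal_le_ofReal (hwc x)) hp.le
        · simp [hwE x fun h => hx (hsub h), hp]
    _ = ENNReal.ofReal c ^ p * μ (ball x₀ r) := by
        rw [lintegral_indicator measurableSet_ball, setLIntegral_const]
    _ < ⊤ := ENNReal.mul_lt_top (ENNReal.rpow_lt_top_of_nonneg hp.le ENNReal.ofReal_ne_top)
        (hball x₀ r hr)

theorem exists_open_varCapacity_le {p : ℝ} (hp : 1 < p) {μ : Measure X}
    (hball : ∀ (x : X) (r : ℝ), 0 < r → μ (ball x r) < ⊤) {E : Set X}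
    (hE : Bornology.IsBounded E) {A : Set X} (hA : A ⊆ interior E) {u : X → EReal}
    (hu : MemNewtonian0 p μ E u) (huq : QuasicontinuousFun p μ u) (huA : ∀ x ∈ A, 1 ≤ u x)
    {g : X → ℝ≥0∞} (hg : IsWeakUpperGradient p μ u g) (hgfin : ∫⁻ x, g x ^ p ∂μ ≠ ⊤)
    {c : ℝ≥0} (hc : 1 < c) {δ : ℝ≥0} (hδ : 0 < δ) :
    ∃ G, IsOpen G ∧ A ⊆ G ∧ G ⊆ E ∧
      varCapacity p μ G E ≤ (c : ℝ≥0∞) ^ p * (∫⁻ x, g x ^ p ∂μ) + δ := by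
  have hp0 : 0 < p := one_pos.trans hp
  have hc0 : (0 : ℝ) < c := by exact_mod_cast one_pos.trans hc
  have hc1 : (1 : ℝ) < c := by exact_mod_cast hc
  obtain ⟨δ', hδ', hsum⟩ :=
    ENNReal.exists_pos_sum_of_countable (ε := (δ : ℝ≥0∞)) (by exact_mod_cast hδ.ne') ℕ
  have hr : ∀ n : ℕ, (0 : ℝ) < 1 / (n + 1) := fun n => Nat.one_div_pos_of_nat
  choose G f h hGo hAG hGE hfm hf0 hf1 hfE hGf hh hhδ using fun n : ℕ =>
    exists_open_correction (μ := μ) (E := E)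
      (A := {x ∈ A | ENNReal.ofReal (1 / (n + 1)) < infEDist x Eᶜ}) hp huq
      (fun x hx => huA x hx.1) (hr n) (fun x hx => hx.2) (s := (c : ℝ)⁻¹)
      (inv_lt_one_of_one_lt₀ hc1) (δ := δ' n) (by exact_mod_cast (hδ' n).ne')
  set F : ℕ → X → ℝ := fun n => Nat.casesOn n (fun x => c * clamp (u x)) f with hF
  set H : ℕ → X → ℝ≥0∞ := fun n => Nat.casesOn n (fun x => c * g x) h with hH
  have hFH : ∀ n, IsWeakUpperGradient p μ (fun x => (F n x : EReal)) (H n) := by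
    rintro (_ | n)
    · exact hg.const_mul_clamp c
    · exact hh n
  have hF0 : ∀ n x, 0 ≤ F n x := by
    rintro (_ | n) x
    · exact mul_nonneg hc0.le (clamp_nonneg _)
    · exact hf0 n x
  have hFc : ∀ n x, F n x ≤ c := by
    rintro (_ | n) x
    · exact mul_le_of_le_one_right hc0.le (clamp_le_one _)
    · exact (hf1 n x).trans hc1.le
  have hFE : ∀ n, ∀ x ∉ E, F n x = 0 := by
    rintro (_ | n) x hx
    · simp [hF, hu.2 x hx, clamp_zero]
    · exact hfE n x hx
  have hFm : ∀ n, AEMeasurable (F n) μ := by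
    rintro (_ | n)
    · exact (measurable_clamp.comp_aemeasurable hu.1.1).const_mul _
    · exact hfm n
  have hbdd : ∀ x, BddAbove (range fun n => F n x) := fun x =>
    ⟨c, by rintro _ ⟨n, rfl⟩; exact hFc n x⟩
  set w : X → ℝ := fun x => ⨆ n, F n x with hw
  have hFw : ∀ n x, F n x ≤ w x := fun n x => le_ciSup (hbdd x) n
  have hgrad : gradEnergy p μ (fun x => (w x : EReal)) ≤
      (c : ℝ≥0∞) ^ p * (∫⁻ x, g x ^ p ∂μ) + δ := by
    refine (gradEnergy_le (IsWeakUpperGradient.ciSup hp0 hbdd hFH)).trans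
      ((lintegral_iSup_rpow_le hp0 fun n => (hFH n).1).trans ?_)
    rw [tsum_eq_zero_add' ENNReal.summable]
    refine add_le_add (le_of_eq ?_) ((ENNReal.tsum_le_tsum hhδ).trans hsum.le)
    rw [← lintegral_const_mul _ (hg.1.pow_const p)]
    exact lintegral_congr fun x => ENNReal.mul_rpow_of_nonneg _ _ hp0.le
  have hwN : MemNewtonian0 p μ E (fun x => (w x : EReal)) := by
    refine memNewtonian0_of_bounded hp0 hball hE (AEMeasurable.iSup hFm) (c := c)
      (fun x => ?_) (fun x hx => ?_) (hgrad.trans_lt ?_)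
    · rw [abs_of_nonneg ((hF0 0 x).trans (hFw 0 x))]
      exact ciSup_le fun n => hFc n x
    · simp [hw, hFE _ x hx]
    · refine ENNReal.add_lt_top.2 ⟨ENNReal.mul_lt_top ?_ hgfin.lt_top, ENNReal.coe_lt_top⟩
      exact ENNReal.rpow_lt_top_of_nonneg hp0.le ENNReal.coe_ne_top
  refine ⟨⋃ n, G n, isOpen_iUnion hGo, fun x hx => ?_, iUnion_subset hGE,
    (iInf₂_le _ ⟨hwN, fun x hx => ?_⟩).trans hgrad⟩
  · have hpos : 0 < infEDist x Eᶜ := by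
      rw [pos_iff_ne_zero, Ne, ← mem_closure_iff_infEDist_zero, closure_compl]
      exact fun h => h (hA hx)
    obtain ⟨n, hn⟩ : ∃ n : ℕ, ENNReal.ofReal (1 / (n + 1)) < infEDist x Eᶜ := by
      have ht := ENNReal.tendsto_ofReal (tendsto_one_div_add_atTop_nhds_zero_nat (𝕜 := ℝ))
      rw [ENNReal.ofReal_zero] at ht
      exact (ht.eventually (gt_mem_nhds hpos)).exists
    exact mem_iUnion.2 ⟨n, hAG n ⟨hx, hn⟩⟩
  · obtain ⟨n, hn⟩ := mem_iUnion.1 hx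
    have : (1 : ℝ) ≤ w x := by
      rcases hGf n x hn with h | h
      · refine le_trans ?_ (hFw 0 x)
        calc (1 : ℝ) = c * (c : ℝ)⁻¹ := (mul_inv_cancel₀ hc0.ne').symm
          _ ≤ c * clamp (u x) := by
            gcongr
            exact le_clamp (inv_le_one_of_one_le₀ hc1.le) h.le
      · exact h.symm.le.trans (hFw (n + 1) x)
    exact EReal.coe_le_coe_iff.2 this

theorem varCapacity_mono {p : ℝ} {μ : Measure X} {A B E : Set X} (h : A ⊆ B) :
    varCapacity p μ A E ≤ varCapacity p μ B E :=
  le_iInf₂ fun u hu => iInf₂_le u ⟨hu.1, fun x hx => hu.2 x (h hx)⟩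

/-- For `p > 1`, if all Newtonian functions are quasicontinuous, then
`cap_p` is an outer capacity for sets `A ⊆ int E`. -/
theorem stmt_11 (p : ℝ) (hp : 1 < p) (μ : Measure X)
    (hball : ∀ (x : X) (r : ℝ), 0 < r → 0 < μ (Metric.ball x r) ∧ μ (Metric.ball x r) < ⊤)
    (hqc : ∀ u : X → EReal, MemNewtonian p μ u → QuasicontinuousFun p μ u)
    (E : Set X) (hE : Bornology.IsBounded E)
    (A : Set X) (hA : A ⊆ interior E) :
    varCapacity p μ A E =
      ⨅ (G : Set X) (_ : IsOpen G ∧ A ⊆ G ∧ G ⊆ E), varCapacity p μ G E := by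
  refine le_antisymm (le_iInf₂ fun G hG => varCapacity_mono hG.2.1) ?_
  refine le_iInf₂ fun u hu => le_iInf₂ fun g hg => ?_
  set I := ∫⁻ x, g x ^ p ∂μ with hI
  rcases eq_or_ne I ⊤ with hItop | hItop
  · exact hItop ▸ le_top
  have hbound : ∀ c : ℝ≥0, 1 < c →
      (⨅ (G : Set X) (_ : IsOpen G ∧ A ⊆ G ∧ G ⊆ E), varCapacity p μ G E) ≤
        (c : ℝ≥0∞) ^ p * I := by
    intro c hc
    refine ENNReal.le_of_forall_pos_le_add fun δ hδ _ => ?_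
    obtain ⟨G, h1, h2, h3, h4⟩ := exists_open_varCapacity_le hp (fun x r hr => (hball x r hr).2)
      hE hA hu.1 (hqc u hu.1.1) hu.2 hg hItop hc hδ
    exact (iInf₂_le G ⟨h1, h2, h3⟩).trans h4
  have hlim : Tendsto (fun c : ℝ≥0 => (c : ℝ≥0∞) ^ p * I) (𝓝[>] 1) (𝓝 I) := by
    have h1 : Tendsto (fun c : ℝ≥0 => (c : ℝ≥0∞) ^ p * I) (𝓝 1)
        (𝓝 (((1 : ℝ≥0) : ℝ≥0∞) ^ p * I)) :=
      ENNReal.Tendsto.mul_const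
        ((ENNReal.continuous_rpow_const.comp ENNReal.continuous_coe).tendsto 1) (Or.inr hItop)
    simp only [ENNReal.coe_one, ENNReal.one_rpow, one_mul] at h1
    exact h1.mono_left nhdsWithin_le_nhds
  exact ge_of_tendsto hlim (eventually_mem_nhdsWithin.mono fun c hc => hbound c hc)

end
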